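/- arXiv:2509.22233 — 3 statements merged into one kernel-verified Lean document; each statement's English description precedes it below -/
import Mathlib

section
/- For any proper 3-coloring c of the grid graph on ℤ × ℤ and any closed walk W in the grid graph (a walk whose first and last vertices coincide), the potential of W is zero: p(W) = 0. -/
/-- Adjacency in the grid graph on ℤ × ℤ. -/
def gridAdj (u v : ℤ × ℤ) : Prop :=
  |u.1 - v.1| + |u.2 - v.2| = 1

/-- The potential of an edge, given a coloring `c`. -/
def pot (c : ℤ × ℤ → ℤ) (u v : ℤ × ℤ) : ℤ :=
  if c u ≠ 3 ∧ c v ≠ 3 then c u - c v else 0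

/-- The potential is antisymmetric. -/
theorem pot_swap (c : ℤ × ℤ → ℤ) (u v : ℤ × ℤ) : pot c u v = -pot c v u := by
  unfold pot
  grind

/-- Every function on `ℤ` is the forward difference of some function. -/
theorem exists_forward_difference_eq (f : ℤ → ℤ) : ∃ F : ℤ → ℤ, ∀ n, F (n + 1) - F n = f n := by
  refine ⟨fun n => ∑ i ∈ Finset.range n.toNat, f i -
    ∑ i ∈ Finset.range (-n).toNat, f (-(i + 1)), fun n => ?_⟩
  obtain ⟨k, rfl | rfl⟩ : ∃ k : ℕ, n = k ∨ n = -(k + 1) :=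
    ⟨if 0 ≤ n then n.toNat else (-n - 1).toNat, by grind⟩
  · have h1 : ((k : ℤ) + 1).toNat = k + 1 := by lia
    have h2 : (-((k : ℤ) + 1)).toNat = 0 := by lia
    simp only [h1, h2, Finset.sum_range_succ]
    simp
  · have h1 : (-((k : ℤ) + 1) + 1).toNat = 0 := by lia
    have h2 : (-(-((k : ℤ) + 1) + 1)).toNat = k := by lia
    have h3 : (-((k : ℤ) + 1)).toNat = 0 := by lia
    have h4 : (-(-((k : ℤ) + 1))).toNat = k + 1 := by lia
    simp only [h1, h2, h3, h4, Finset.sum_range_succ]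
    simp

/-- The potential around a properly 3-colored 4-cycle vanishes: one of the two pairs of opposite
vertices has equal colors. -/
theorem pot_add_pot_eq_of_four_cycle (c : ℤ × ℤ → ℤ)
    (hc_range : ∀ v, c v = 1 ∨ c v = 2 ∨ c v = 3) {a b d e : ℤ × ℤ}
    (hab : c a ≠ c b) (hbd : c b ≠ c d) (hae : c a ≠ c e) (hed : c e ≠ c d) :
    pot c a b + pot c b d = pot c a e + pot c e d := by
  have ha := hc_range a
  have hb := hc_range b
  have hd := hc_range d
  have he := hc_range e
  unfold pot
  grind

/-- The potential of a proper 3-coloring is the difference of a height function. -/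
theorem exists_height (c : ℤ × ℤ → ℤ)
    (hc_range : ∀ v, c v = 1 ∨ c v = 2 ∨ c v = 3)
    (hc_proper : ∀ u v, gridAdj u v → c u ≠ c v) :
    ∃ h : ℤ × ℤ → ℤ, ∀ u v, gridAdj u v → pot c u v = h v - h u := by
  obtain ⟨F, hF⟩ := exists_forward_difference_eq fun x => pot c (x, 0) (x + 1, 0)
  choose G hG using fun x => exists_forward_difference_eq fun y => pot c (x, y) (x, y + 1)
  have hsquare (x y : ℤ) : pot c (x, y) (x + 1, y) + pot c (x + 1, y) (x + 1, y + 1) =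
      pot c (x, y) (x, y + 1) + pot c (x, y + 1) (x + 1, y + 1) := by
    apply pot_add_pot_eq_of_four_cycle c hc_range <;>
      exact hc_proper _ _ (by simp [gridAdj])
  have hhor (x y : ℤ) : pot c (x, y) (x + 1, y) =
      F (x + 1) + (G (x + 1) y - G (x + 1) 0) - (F x + (G x y - G x 0)) := by
    induction y using Int.induction_on with
    | zero => linarith [hF x]
    | succ i ih => linarith [hsquare x i, hG x i, hG (x + 1) i]
    | pred i ih =>
      have h1 := hsquare x (-i - 1)
      have h2 := hG x (-i - 1)
      have h3 := hG (x + 1) (-i - 1)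
      rw [sub_add_cancel] at h1 h2 h3
      linarith
  refine ⟨fun u => F u.1 + (G u.1 u.2 - G u.1 0), ?_⟩
  rintro ⟨x, y⟩ ⟨x₁, y₁⟩ huv
  simp only [gridAdj] at huv
  obtain ⟨rfl, rfl⟩ | ⟨rfl, rfl⟩ | ⟨rfl, rfl⟩ | ⟨rfl, rfl⟩ :
      (x₁ = x + 1 ∧ y₁ = y) ∨ (x = x₁ + 1 ∧ y₁ = y) ∨
      (x₁ = x ∧ y₁ = y + 1) ∨ (x₁ = x ∧ y = y₁ + 1) := by grind
  · exact hhor x y₁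
  · rw [pot_swap, hhor]
    ring
  · linarith [hG x₁ y]
  · rw [pot_swap]
    linarith [hG x₁ y₁]

/-- For any proper 3-coloring `c` of the grid graph on ℤ × ℤ and any closed walk
`w 0, w 1, …, w m` (i.e. `w 0 = w m`) in the grid graph, the potential of the walk
is zero. -/
theorem potential_closed_walk_eq_zero
    (c : ℤ × ℤ → ℤ)
    (hc_range : ∀ v, c v = 1 ∨ c v = 2 ∨ c v = 3)
    (hc_proper : ∀ u v, gridAdj u v → c u ≠ c v)
    (m : ℕ) (w : ℕ → ℤ × ℤ)
    (hwalk : ∀ i, i < m → gridAdj (w i) (w (i + 1)))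
    (hclosed : w 0 = w m) :
    ∑ i ∈ Finset.range m, pot c (w i) (w (i + 1)) = 0 := by
  obtain ⟨h, hh⟩ := exists_height c hc_range hc_proper
  rw [Finset.sum_congr rfl fun i hi => hh _ _ (hwalk i (Finset.mem_range.mp hi)),
    Finset.sum_range_sub fun i => h (w i), hclosed, sub_self]
end

section
/- Let c be a proper 3-coloring of the grid graph on ℤ × ℤ. Let a ≤ b and y₁, y₂ be integers, let P₁ be the horizontal path (a, y₁), (a+1, y₁), …, (b, y₁), and let P₂ be the horizontal path (a, y₂), (a+1, y₂), …, (b, y₂). Then |p(P₁) - p(P₂)| ≤ 2·|y₁ - y₂|. -/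
/-- The potential of the horizontal path `(a, y), (a+1, y), …, (b, y)`. -/
def rowPotential (c : ℤ × ℤ → ℤ) (a b y : ℤ) : ℤ :=
  ∑ i ∈ Finset.range (b - a).toNat,
    pot c (a + (i : ℤ), y) (a + (i : ℤ) + 1, y)

/-- The potential of a pair of vertices in a 3-coloring is at most one in absolute value. -/
lemma abs_pot_le_one (c : ℤ × ℤ → ℤ)
    (hc_range : ∀ v, c v = 1 ∨ c v = 2 ∨ c v = 3) (u v : ℤ × ℤ) :
    |pot c u v| ≤ 1 := by
  rw [abs_le]
  unfold pot
  rcases hc_range u with hu | hu | hu <;> rcases hc_range v with hv | hv | hv <;>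
    simp [hu, hv]

/-- Both ways around a properly 3-colored 4-cycle have the same potential. -/
lemma pot_square (c : ℤ × ℤ → ℤ)
    (hc_range : ∀ v, c v = 1 ∨ c v = 2 ∨ c v = 3) {u v w z : ℤ × ℤ}
    (huv : c u ≠ c v) (hvz : c v ≠ c z) (huw : c u ≠ c w) (hwz : c w ≠ c z) :
    pot c u v + pot c v z = pot c u w + pot c w z := by
  unfold pot
  rcases hc_range u with hu | hu | hu <;> rcases hc_range v with hv | hv | hv <;>
    rcases hc_range w with hw | hw | hw <;> rcases hc_range z with hz | hz | hz <;>
    simp_all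

/-- The potentials of two adjacent rows differ by the potentials of the two vertical edges
joining their ends. -/
lemma sum_pot_add_pot (c : ℤ × ℤ → ℤ)
    (hc_range : ∀ v, c v = 1 ∨ c v = 2 ∨ c v = 3)
    (hc_proper : ∀ u v, gridAdj u v → c u ≠ c v) (a y : ℤ) (n : ℕ) :
    ∑ i ∈ Finset.range n, pot c (a + (i : ℤ), y) (a + (i : ℤ) + 1, y)
        + pot c (a + n, y) (a + n, y + 1)
      = pot c (a, y) (a, y + 1)
        + ∑ i ∈ Finset.range n, pot c (a + (i : ℤ), y + 1) (a + (i : ℤ) + 1, y + 1) := by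
  induction n with
  | zero => simp
  | succ n ih =>
    have hsq := pot_square c hc_range (u := (a + n, y)) (v := (a + n + 1, y))
      (w := (a + n, y + 1)) (z := (a + n + 1, y + 1))
      (hc_proper _ _ (by simp [gridAdj])) (hc_proper _ _ (by simp [gridAdj]))
      (hc_proper _ _ (by simp [gridAdj])) (hc_proper _ _ (by simp [gridAdj]))
    rw [Finset.sum_range_succ, Finset.sum_range_succ]
    push_cast
    rw [← add_assoc a (n : ℤ) 1]
    linarith

lemma abs_rowPotential_sub_succ_le (c : ℤ × ℤ → ℤ)
    (hc_range : ∀ v, c v = 1 ∨ c v = 2 ∨ c v = 3)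
    (hc_proper : ∀ u v, gridAdj u v → c u ≠ c v) (a b y : ℤ) :
    |rowPotential c a b y - rowPotential c a b (y + 1)| ≤ 2 := by
  have h := sum_pot_add_pot c hc_range hc_proper a y (b - a).toNat
  have hl := abs_le.1 (abs_pot_le_one c hc_range (a, y) (a, y + 1))
  have hr := abs_le.1 (abs_pot_le_one c hc_range
    (a + ((b - a).toNat : ℤ), y) (a + ((b - a).toNat : ℤ), y + 1))
  unfold rowPotential
  rw [abs_le]
  constructor <;> linarith [hl.1, hl.2, hr.1, hr.2]

lemma abs_rowPotential_sub_add_natCast_le (c : ℤ × ℤ → ℤ)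
    (hc_range : ∀ v, c v = 1 ∨ c v = 2 ∨ c v = 3)
    (hc_proper : ∀ u v, gridAdj u v → c u ≠ c v) (a b y : ℤ) (n : ℕ) :
    |rowPotential c a b y - rowPotential c a b (y + n)| ≤ 2 * n := by
  induction n with
  | zero => simp
  | succ n ih =>
    have h := abs_rowPotential_sub_succ_le c hc_range hc_proper a b (y + n)
    have htri := abs_sub_le (rowPotential c a b y) (rowPotential c a b (y + n))
      (rowPotential c a b (y + n + 1))
    push_cast
    rw [← add_assoc y (n : ℤ) 1]
    linarith

/-- Let `c` be a proper 3-coloring of the grid graph on ℤ × ℤ. Let `a ≤ b` and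
`y₁, y₂` be integers, let `P₁` be the horizontal path `(a, y₁), …, (b, y₁)` and `P₂`
the horizontal path `(a, y₂), …, (b, y₂)`. Then `|p(P₁) - p(P₂)| ≤ 2·|y₁ - y₂|`. -/
theorem potential_parallel_rows
    (c : ℤ × ℤ → ℤ)
    (hc_range : ∀ v, c v = 1 ∨ c v = 2 ∨ c v = 3)
    (hc_proper : ∀ u v, gridAdj u v → c u ≠ c v)
    (a b y₁ y₂ : ℤ) (hab : a ≤ b) :
    |rowPotential c a b y₁ - rowPotential c a b y₂| ≤ 2 * |y₁ - y₂| := by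
  rcases le_total y₁ y₂ with h | h
  · obtain ⟨n, rfl⟩ := Int.le.dest h
    simpa using abs_rowPotential_sub_add_natCast_le c hc_range hc_proper a b y₁ n
  · obtain ⟨n, rfl⟩ := Int.le.dest h
    rw [abs_sub_comm]
    simpa using abs_rowPotential_sub_add_natCast_le c hc_range hc_proper a b y₂ n
end

section
/- (Discrete mean value theorem.) Let b and k be positive integers and let f : {0, 1, …, b} → ℤ be a function satisfying |f(x+1) - f(x)| ≤ k for all x ∈ {0, 1, …, b-1}, with f(0) = f(b) = 0. Fix an integer ℓ with 0 < ℓ and ℓ² < b, and define g(x) = f(x+ℓ) - f(x) for x ∈ {0, 1, …, b-ℓ}. Then there exists an integer x ∈ {0, 1, …, b-ℓ} such that |g(x)| ≤ 2k. -/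
/-- A function whose steps on `{0,…,b}` are at least `-k` loses at most `n * k` over `n` steps. -/
theorem sub_mul_le_of_neg_le_step {b k : ℤ} {f : ℤ → ℤ}
    (hstep : ∀ x, 0 ≤ x → x ≤ b - 1 → -k ≤ f (x + 1) - f x) {x : ℤ} (hx : 0 ≤ x) (n : ℕ)
    (hn : x + n ≤ b) : f x - n * k ≤ f (x + n) := by
  induction n with
  | zero => simp
  | succ n ih =>
    push_cast at hn ⊢
    have h₁ := ih (by lia)
    have h₂ := hstep (x + n) (by lia) (by lia)
    rw [← add_assoc]
    linarith

/-- If every `ℓ`-increment of `f` on `{0,…,b}` is at least `c`, then `f` gains at least `n * c`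
over `n` consecutive blocks of length `ℓ` starting at `0`. -/
theorem add_mul_le_of_le_increment {b c ℓ : ℤ} {f : ℤ → ℤ} (hℓ : 0 ≤ ℓ)
    (hg : ∀ x, 0 ≤ x → x ≤ b - ℓ → c ≤ f (x + ℓ) - f x) (n : ℕ) (hn : n * ℓ ≤ b) :
    f 0 + n * c ≤ f (n * ℓ) := by
  induction n with
  | zero => simp
  | succ n ih =>
    push_cast at hn ⊢
    have h₁ := ih (by linarith)
    have h₂ := hg (n * ℓ) (by positivity) (by linarith)
    rw [add_one_mul (n : ℤ) ℓ]
    linarith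

/-- Large `ℓ`-increments, with steps at least `-k` and `ℓ² < b`, force `f 0 < f b`. -/
theorem lt_of_two_mul_lt_increment {b k ℓ : ℤ} {f : ℤ → ℤ} (hk : 0 < k) (hℓ : 0 < ℓ)
    (hsq : ℓ ^ 2 < b) (hstep : ∀ x, 0 ≤ x → x ≤ b - 1 → -k ≤ f (x + 1) - f x)
    (hg : ∀ x, 0 ≤ x → x ≤ b - ℓ → 2 * k < f (x + ℓ) - f x) : f 0 < f b := by
  have hdiv : b / ℓ * ℓ + b % ℓ = b := Int.ediv_mul_add_emod b ℓ
  have hr₀ : 0 ≤ b % ℓ := Int.emod_nonneg b hℓ.ne'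
  have hr : b % ℓ < ℓ := Int.emod_lt_of_pos b hℓ
  have hq : ℓ ≤ b / ℓ := (Int.le_ediv_iff_mul_le hℓ).2 (by nlinarith)
  obtain ⟨q, hq'⟩ := Int.eq_ofNat_of_zero_le (hℓ.le.trans hq)
  obtain ⟨r, hr'⟩ := Int.eq_ofNat_of_zero_le hr₀
  rw [hq', hr'] at hdiv
  rw [hq'] at hq
  rw [hr'] at hr
  have h₁ := add_mul_le_of_le_increment hℓ.le (fun x hx hxb => (hg x hx hxb).le) q (by lia)
  have h₂ := sub_mul_le_of_neg_le_step hstep (x := q * ℓ) (by positivity) r hdiv.le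
  rw [hdiv] at h₂
  nlinarith

/-- If `f` has steps at most `k` in absolute value and its `ℓ`-increments all exceed `2k` in
absolute value, then positivity of the first increment propagates to all of them. -/
theorem two_mul_lt_increment_of_zero {b k ℓ : ℤ} {f : ℤ → ℤ} (hk : 0 < k) (hℓ : 0 < ℓ)
    (hstep : ∀ x, 0 ≤ x → x ≤ b - 1 → |f (x + 1) - f x| ≤ k)
    (hg : ∀ x, 0 ≤ x → x ≤ b - ℓ → 2 * k < |f (x + ℓ) - f x|)
    (hpos : 0 < f ℓ - f 0) (x : ℤ) (hx : 0 ≤ x) :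
    x ≤ b - ℓ → 2 * k < f (x + ℓ) - f x := by
  induction x, hx using Int.leInduction with
  | base =>
    intro h
    have h₁ := hg 0 le_rfl h
    rw [zero_add] at h₁ ⊢
    rwa [abs_of_pos hpos] at h₁
  | succ x hx ih =>
    intro h
    have h₁ := ih (by lia)
    have h₂ := abs_le.1 (hstep x hx (by lia))
    have h₃ := abs_le.1 (hstep (x + ℓ) (by lia) (by lia))
    rw [add_right_comm] at h₃
    rcases lt_abs.1 (hg (x + 1) (by lia) h) with h₄ | h₄ <;> linarith

/-- Discrete mean value theorem: if `f : {0,…,b} → ℤ` changes by at most `k` at each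
step and `f 0 = f b = 0`, then for any `ℓ` with `0 < ℓ` and `ℓ² < b`, there is an
`x ∈ {0,…,b-ℓ}` with `|f (x+ℓ) - f x| ≤ 2k`. -/
theorem discrete_mvt
    (b k : ℤ) (hb : 0 < b) (hk : 0 < k)
    (f : ℤ → ℤ)
    (hstep : ∀ x, 0 ≤ x → x ≤ b - 1 → |f (x + 1) - f x| ≤ k)
    (h0 : f 0 = 0) (hb' : f b = 0)
    (ℓ : ℤ) (hℓpos : 0 < ℓ) (hℓsq : ℓ ^ 2 < b) :
    ∃ x, 0 ≤ x ∧ x ≤ b - ℓ ∧ |f (x + ℓ) - f x| ≤ 2 * k := by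
  by_contra! hg
  have hℓb : ℓ ≤ b := by nlinarith
  have h := hg 0 le_rfl (by lia)
  rw [zero_add] at h
  rcases lt_abs.1 h with h | h
  · have := lt_of_two_mul_lt_increment hk hℓpos hℓsq
      (fun x hx hxb => (abs_le.1 (hstep x hx hxb)).1)
      (two_mul_lt_increment_of_zero hk hℓpos hstep hg (by lia))
    lia
  · have hstep' : ∀ x, 0 ≤ x → x ≤ b - 1 → |(-f) (x + 1) - (-f) x| ≤ k := fun x hx hxb => by
      simpa only [Pi.neg_apply, neg_sub_neg, abs_sub_comm] using hstep x hx hxb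
    have hg' : ∀ x, 0 ≤ x → x ≤ b - ℓ → 2 * k < |(-f) (x + ℓ) - (-f) x| := fun x hx hxb => by
      simpa only [Pi.neg_apply, neg_sub_neg, abs_sub_comm] using hg x hx hxb
    have := lt_of_two_mul_lt_increment hk hℓpos hℓsq
      (fun x hx hxb => (abs_le.1 (hstep' x hx hxb)).1)
      (two_mul_lt_increment_of_zero hk hℓpos hstep' hg' (by simp only [Pi.neg_apply]; lia))
    simp only [Pi.neg_apply] at this
    lia
end
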